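/- arXiv:2310.06193 — 3 statements merged into one kernel-verified Lean document; each statement's English description precedes it below -/
import Mathlib

section
/- Let θ ∈ ℝ¹⁰ be such that f(θ) is positive definite, and let g(θ) be the 10×10 real matrix with entries [g(θ)]_{ij} = (1/2)·tr( f(θ)⁻¹ f(eᵢ) f(θ)⁻¹ f(eⱼ) ), where e₁,…,e₁₀ is the canonical basis of ℝ¹⁰. Then g(θ) is symmetric and positive definite; in particular it is invertible. -/
open Matrix

/-- The 3×3 inertia matrix built from the inertial-parameter vector
`θ = (m, h₁, h₂, h₃, Ixx, Iyy, Izz, Ixy, Iyz, Izx)`. -/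
def inertiaMat (θ : Fin 10 → ℝ) : Matrix (Fin 3) (Fin 3) ℝ :=
  !![θ 4, θ 7, θ 9;
     θ 7, θ 5, θ 8;
     θ 9, θ 8, θ 6]

/-- `Σ(θ) = (1/2)·tr(I(θ))·Id₃ − I(θ)`. -/
noncomputable def sigmaMat (θ : Fin 10 → ℝ) : Matrix (Fin 3) (Fin 3) ℝ :=
  ((1 / 2) * (inertiaMat θ).trace) • (1 : Matrix (Fin 3) (Fin 3) ℝ) - inertiaMat θ

/-- `h(θ) = (h₁, h₂, h₃)ᵀ`. -/
def hVec (θ : Fin 10 → ℝ) : Fin 3 → ℝ := ![θ 1, θ 2, θ 3]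

/-- The linear map `f : ℝ¹⁰ → S(4)`, `f(θ) = [[Σ(θ), h(θ)], [h(θ)ᵀ, m]]` in block form. -/
noncomputable def fMap (θ : Fin 10 → ℝ) : Matrix (Fin 4) (Fin 4) ℝ :=
  Matrix.of fun i j =>
    if hi : (i : ℕ) < 3 then
      if hj : (j : ℕ) < 3 then sigmaMat θ ⟨i, hi⟩ ⟨j, hj⟩
      else hVec θ ⟨i, hi⟩
    else
      if hj : (j : ℕ) < 3 then hVec θ ⟨j, hj⟩
      else θ 0


/-- The pullback `g(θ)` of the affine-invariant Riemannian metric on `𝒫(4)` to `ℝ¹⁰`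
under `f`: `[g(θ)]_{ij} = (1/2)·tr(f(θ)⁻¹ f(eᵢ) f(θ)⁻¹ f(eⱼ))`, where `e₁, …, e₁₀` is
the canonical basis of `ℝ¹⁰`. -/
noncomputable def gMat (θ : Fin 10 → ℝ) : Matrix (Fin 10) (Fin 10) ℝ :=
  Matrix.of fun i j =>
    (1 / 2) * ((fMap θ)⁻¹ * fMap (Pi.single i 1) * (fMap θ)⁻¹ * fMap (Pi.single j 1)).trace

/-- For `P` positive definite and `X ≠ 0` symmetric, `tr(P X P X)` is positive: writing `P = Bᴴ B`,
it is the squared Frobenius norm of `B X Bᴴ`. -/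
theorem trace_posDef_mul_mul_mul_pos {n : Type*} [Fintype n] [DecidableEq n]
    {P X : Matrix n n ℝ} (hP : P.PosDef) (hX : X.IsHermitian) (hX0 : X ≠ 0) :
    0 < (P * X * P * X).trace := by
  obtain ⟨B, hB, rfl⟩ : ∃ B : Matrix n n ℝ, IsUnit B ∧ P = Bᴴ * B := by
    open scoped MatrixOrder Matrix.Norms.L2Operator in
    exact CStarAlgebra.isStrictlyPositive_iff_eq_star_mul_self.mp hP.isStrictlyPositive
  have hY : B * X * Bᴴ ≠ 0 := fun h => hX0 <| by
    rwa [IsUnit.mul_left_eq_zero (b := Bᴴ) hB.star, hB.mul_right_eq_zero] at h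
  have htr : (Bᴴ * B * X * (Bᴴ * B) * X).trace = ((B * X * Bᴴ)ᴴ * (B * X * Bᴴ)).trace := by
    rw [(isHermitian_mul_mul_conjTranspose B hX).eq]
    simp only [Matrix.mul_assoc]
    rw [trace_mul_comm]
    simp only [Matrix.mul_assoc]
  rw [htr]
  exact (posSemidef_conjTranspose_mul_self _).trace_nonneg.lt_of_ne'
    (trace_conjTranspose_mul_self_eq_zero_iff.not.mpr hY)

theorem fMap_isHermitian (θ : Fin 10 → ℝ) : (fMap θ).IsHermitian := by
  ext i j
  fin_cases i <;> fin_cases j <;> simp [fMap, sigmaMat, inertiaMat]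

theorem isLinearMap_fMap : IsLinearMap ℝ fMap where
  map_add x y := by
    ext i j
    fin_cases i <;> fin_cases j <;>
      simp [fMap, sigmaMat, inertiaMat, hVec, trace_fin_three] <;> ring
  map_smul c x := by
    ext i j
    fin_cases i <;> fin_cases j <;>
      simp [fMap, sigmaMat, inertiaMat, hVec, trace_fin_three] <;> ring

theorem fMap_eq_zero {θ : Fin 10 → ℝ} (h : fMap θ = 0) : θ = 0 := by
  have entry (i j : Fin 4) : fMap θ i j = 0 := by rw [h]; rfl
  have h00 := entry 0 0
  have h11 := entry 1 1
  have h22 := entry 2 2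
  have h01 := entry 0 1
  have h12 := entry 1 2
  have h02 := entry 0 2
  have h03 := entry 0 3
  have h13 := entry 1 3
  have h23 := entry 2 3
  have h33 := entry 3 3
  simp [fMap, sigmaMat, inertiaMat, hVec, trace_fin_three] at *
  ext k
  fin_cases k <;> simp <;> linarith

theorem fMap_eq_sum (x : Fin 10 → ℝ) : fMap x = ∑ i, x i • fMap (Pi.single i 1) := by
  have single_eq (i : Fin 10) : (Pi.single i 1 : Fin 10 → ℝ) = fun j => if i = j then 1 else 0 := by
    ext j
    simp [Pi.single_apply, eq_comm]
  simpa only [single_eq, IsLinearMap.mk'_apply] using (isLinearMap_fMap.mk' fMap).pi_apply_eq_sum_univ x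

theorem gMat_isSymm (θ : Fin 10 → ℝ) : (gMat θ).IsSymm := by
  ext i j
  simp only [gMat, transpose_apply, of_apply]
  rw [Matrix.mul_assoc, trace_mul_comm, ← Matrix.mul_assoc]

/-- The quadratic form of `g(θ)` is `x ↦ (1/2)·tr(f(θ)⁻¹ f(x) f(θ)⁻¹ f(x))`. -/
theorem dotProduct_gMat_mulVec (θ x : Fin 10 → ℝ) :
    x ⬝ᵥ (gMat θ *ᵥ x) = (1 / 2) * ((fMap θ)⁻¹ * fMap x * (fMap θ)⁻¹ * fMap x).trace := by
  conv_rhs => rw [fMap_eq_sum x]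
  simp only [dotProduct, mulVec, gMat, of_apply, Finset.mul_sum, Finset.sum_mul, trace_sum,
    Matrix.mul_smul, Matrix.smul_mul, trace_smul, smul_eq_mul]
  rw [Finset.sum_comm]
  refine Finset.sum_congr rfl fun i _ => Finset.sum_congr rfl fun j _ => ?_
  ring

/-- If `θ ∈ ℝ¹⁰` is such that `f(θ)` is positive definite, then the
pullback metric matrix `g(θ)` is symmetric and positive definite; in particular it is
invertible. -/
theorem gMat_symm_posDef_invertible (θ : Fin 10 → ℝ) (hθ : (fMap θ).PosDef) :
    (gMat θ).IsSymm ∧ (gMat θ).PosDef ∧ IsUnit (gMat θ).det := by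
  have hpos : (gMat θ).PosDef := by
    refine .of_dotProduct_mulVec_pos (by simpa using gMat_isSymm θ) fun x hx => ?_
    rw [star_trivial, dotProduct_gMat_mulVec]
    have := trace_posDef_mul_mul_mul_pos hθ.inv (fMap_isHermitian x) (mt fMap_eq_zero hx)
    positivity
  exact ⟨gMat_isSymm θ, hpos, hpos.det_pos.ne'.isUnit⟩
end

section
/- For all θ₁, θ₂ ∈ ℝ¹⁰ with f(θ₁) and f(θ₂) positive definite, the pseudo-distance D_ℳ(θ₁‖θ₂) := D(f(θ₂)‖f(θ₁)) = log(det f(θ₁)/det f(θ₂)) + tr(f(θ₁)⁻¹ f(θ₂)) − 4 is nonnegative, and it equals zero if and only if θ₁ = θ₂. -/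
open Matrix

theorem fMap_injective : Function.Injective fMap := by
  intro θ₁ θ₂ h
  have e (i j : Fin 4) : fMap θ₁ i j = fMap θ₂ i j := by rw [h]
  have e00 := e 0 0
  have e11 := e 1 1
  have e22 := e 2 2
  have e33 := e 3 3
  have e01 := e 0 1
  have e02 := e 0 2
  have e12 := e 1 2
  have e03 := e 0 3
  have e13 := e 1 3
  have e23 := e 2 3
  simp [fMap, sigmaMat, inertiaMat, hVec, Matrix.trace, Fin.sum_univ_three, Matrix.one_apply]
    at e00 e11 e22 e33 e01 e02 e12 e03 e13 e23
  funext i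
  fin_cases i <;> simp <;> linarith

namespace Matrix.PosDef

variable {n : Type*} [Fintype n] [DecidableEq n]

theorem trace_sub_card_sub_log_det_eq_sum {C : Matrix n n ℝ} (hC : C.PosDef) :
    C.trace - Fintype.card n - Real.log C.det =
      ∑ i, (hC.isHermitian.eigenvalues i - 1 - Real.log (hC.isHermitian.eigenvalues i)) := by
  have htr := hC.isHermitian.trace_eq_sum_eigenvalues
  have hdet := hC.isHermitian.det_eq_prod_eigenvalues
  simp only [RCLike.ofReal_real_eq_id, id_eq] at htr hdet
  rw [htr, hdet, Real.log_prod fun i _ => (hC.eigenvalues_pos i).ne']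
  simp [Finset.sum_sub_distrib]

theorem log_det_le_trace_sub_card {C : Matrix n n ℝ} (hC : C.PosDef) :
    Real.log C.det ≤ C.trace - Fintype.card n := by
  rw [← sub_nonneg, hC.trace_sub_card_sub_log_det_eq_sum]
  exact Finset.sum_nonneg fun i _ =>
    sub_nonneg.2 (Real.log_le_sub_one_of_pos (hC.eigenvalues_pos i))

theorem eq_one_of_log_det_eq {C : Matrix n n ℝ} (hC : C.PosDef)
    (h : Real.log C.det = C.trace - Fintype.card n) : C = 1 := by
  have hsum := hC.trace_sub_card_sub_log_det_eq_sum
  rw [h, sub_self, eq_comm, Finset.sum_eq_zero_iff_of_nonneg fun i _ =>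
    sub_nonneg.2 (Real.log_le_sub_one_of_pos (hC.eigenvalues_pos i))] at hsum
  have hone : hC.isHermitian.eigenvalues = 1 := by
    funext i
    by_contra hi
    have := Real.log_lt_sub_one_of_pos (hC.eigenvalues_pos i) hi
    linarith [hsum i (Finset.mem_univ i)]
  rw [hC.isHermitian.spectral_theorem, hone]
  have : (RCLike.ofReal ∘ (1 : n → ℝ) : n → ℝ) = 1 := by ext; simp
  rw [this, Matrix.diagonal_one', map_one]

open scoped MatrixOrder in
/-- Any two positive definite matrices `P`, `Q` admit a positive definite `C` similar to
`P⁻¹ * Q`. -/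
theorem exists_similar_inv_mul {P Q : Matrix n n ℝ} (hP : P.PosDef) (hQ : Q.PosDef) :
    ∃ C : Matrix n n ℝ, C.PosDef ∧ C.trace = (P⁻¹ * Q).trace ∧ C.det = (P⁻¹ * Q).det ∧
      (C = 1 → P = Q) := by
  obtain ⟨y, hy, hPy⟩ := CStarAlgebra.isStrictlyPositive_iff_eq_star_mul_self.mp
    hP.inv.isStrictlyPositive
  refine ⟨y * Q * star y, (IsUnit.posDef_star_right_conjugate_iff hy).2 hQ, ?_, ?_, fun h => ?_⟩
  · rw [hPy, Matrix.trace_mul_comm, mul_assoc]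
  · rw [hPy, Matrix.det_mul, Matrix.det_mul, Matrix.det_mul, Matrix.det_mul]
    ring
  · have hmul : P⁻¹ * Q = 1 := by
      rw [hPy, mul_assoc]
      exact mul_eq_one_comm.1 h
    rw [← Matrix.inv_eq_right_inv hmul, Matrix.nonsing_inv_nonsing_inv _ hP.det_pos.ne'.isUnit]

theorem _root_.Matrix.log_det_inv_mul {P Q : Matrix n n ℝ} :
    Real.log (P⁻¹ * Q).det = -Real.log (P.det / Q.det) := by
  rw [Matrix.det_mul, Matrix.det_nonsing_inv, Ring.inverse_eq_inv', ← Real.log_inv, inv_div,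
    div_eq_inv_mul]

/-- Nonnegativity of the log-det Bregman divergence. -/
theorem bregman_nonneg {P Q : Matrix n n ℝ} (hP : P.PosDef) (hQ : Q.PosDef) :
    0 ≤ Real.log (P.det / Q.det) + (P⁻¹ * Q).trace - Fintype.card n := by
  obtain ⟨C, hC, htr, hdet, -⟩ := hP.exists_similar_inv_mul hQ
  have := hC.log_det_le_trace_sub_card
  rw [htr, hdet, log_det_inv_mul] at this
  linarith

/-- The log-det Bregman divergence vanishes exactly on the diagonal. -/
theorem bregman_eq_zero_iff {P Q : Matrix n n ℝ} (hP : P.PosDef) (hQ : Q.PosDef) :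
    Real.log (P.det / Q.det) + (P⁻¹ * Q).trace - Fintype.card n = 0 ↔ P = Q := by
  constructor
  · intro h
    obtain ⟨C, hC, htr, hdet, hone⟩ := hP.exists_similar_inv_mul hQ
    refine hone (hC.eq_one_of_log_det_eq ?_)
    rw [htr, hdet, log_det_inv_mul]
    linarith
  · rintro rfl
    rw [div_self hP.det_pos.ne', Matrix.nonsing_inv_mul _ hP.det_pos.ne'.isUnit]
    simp

end Matrix.PosDef

/-- For all `θ₁, θ₂ ∈ ℝ¹⁰` with `f(θ₁)` and `f(θ₂)` positive definite,
the pseudo-distance `D_ℳ(θ₁‖θ₂) := D(f(θ₂)‖f(θ₁)) =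
log(det f(θ₁)/det f(θ₂)) + tr(f(θ₁)⁻¹ f(θ₂)) − 4` is nonnegative, and it vanishes iff
`θ₁ = θ₂`. -/
theorem bregman_pseudo_distance_on_M (θ₁ θ₂ : Fin 10 → ℝ)
    (h₁ : (fMap θ₁).PosDef) (h₂ : (fMap θ₂).PosDef) :
    0 ≤ Real.log ((fMap θ₁).det / (fMap θ₂).det) + ((fMap θ₁)⁻¹ * fMap θ₂).trace - 4 ∧
    (Real.log ((fMap θ₁).det / (fMap θ₂).det) + ((fMap θ₁)⁻¹ * fMap θ₂).trace - 4 = 0 ↔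
      θ₁ = θ₂) := by
  have hnonneg := h₁.bregman_nonneg h₂
  have hzero := h₁.bregman_eq_zero_iff h₂
  simp only [Fintype.card_fin, Nat.cast_ofNat] at hnonneg hzero
  exact ⟨hnonneg, hzero.trans fMap_injective.eq_iff⟩
end

section
/- (Proposition 2, joint position error.) Let n ≥ 1, let K_q be an n×n real symmetric positive definite matrix with smallest eigenvalue k > 0, let w : [0,∞) → ℝⁿ be continuous, and let q : [0,∞) → ℝⁿ be differentiable and satisfy q′(t) = −K_q q(t) + w(t) for all t ≥ 0. Then the asymptotic bound ‖q‖ₐ ≤ (1/k)·‖w‖ₐ holds, i.e. limsup_{t→∞} ‖q(t)‖ ≤ (1/λ_min(K_q))·limsup_{t→∞} ‖w(t)‖. -/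
open Matrix Filter

open scoped ENNReal

/-- The quadratic form of a Hermitian matrix is bounded below by any lower bound of its
eigenvalues. -/
lemma Matrix.IsHermitian.mul_norm_sq_le_inner_toEuclideanLin {ι : Type*} [Fintype ι]
    [DecidableEq ι] {A : Matrix ι ι ℝ} (hA : A.IsHermitian) {k : ℝ}
    (hk : ∀ i, k ≤ hA.eigenvalues i) (x : EuclideanSpace ℝ ι) :
    k * ‖x‖ ^ 2 ≤ inner ℝ x (Matrix.toEuclideanLin A x) := by
  have hinner (i : ι) : inner ℝ (hA.eigenvectorBasis i) (Matrix.toEuclideanLin A x) =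
      hA.eigenvalues i * inner ℝ (hA.eigenvectorBasis i) x := by
    have hsymm := Matrix.isSymmetric_toEuclideanLin_iff.mpr hA
    have heig : Matrix.toEuclideanLin A (hA.eigenvectorBasis i) =
        hA.eigenvalues i • hA.eigenvectorBasis i := by
      ext j
      simpa using congrFun (hA.mulVec_eigenvectorBasis i) j
    rw [← hsymm, heig, real_inner_smul_left]
  rw [← real_inner_self_eq_norm_sq, ← hA.eigenvectorBasis.sum_inner_mul_inner x x,
    ← hA.eigenvectorBasis.sum_inner_mul_inner x (Matrix.toEuclideanLin A x), Finset.mul_sum]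
  refine Finset.sum_le_sum fun i _ => ?_
  rw [hinner, real_inner_comm x]
  nlinarith [mul_le_mul_of_nonneg_right (hk i)
    (mul_self_nonneg (inner ℝ x (hA.eigenvectorBasis i)))]

/-- A scalar function satisfying `V' ≤ -k (V - m)` for large times is eventually below every
level above `m`. -/
lemma eventually_lt_of_hasDerivAt_le {V V' : ℝ → ℝ} {k m c T : ℝ} (hk : 0 < k)
    (hV : ∀ t, T ≤ t → HasDerivAt V (V' t) t) (hV' : ∀ t, T ≤ t → V' t ≤ -k * (V t - m))
    (hc : m < c) : ∀ᶠ t in atTop, V t < c := by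
  have hderiv (t : ℝ) (ht : T ≤ t) : HasDerivAt (fun s => Real.exp (k * s) * (V s - m))
      (Real.exp (k * t) * k * (V t - m) + Real.exp (k * t) * V' t) t := by
    have hexp : HasDerivAt (fun s => Real.exp (k * s)) (Real.exp (k * t) * k) t := by
      simpa using ((hasDerivAt_id t).const_mul k).exp
    exact hexp.mul ((hV t ht).sub_const m)
  have hanti : AntitoneOn (fun s => Real.exp (k * s) * (V s - m)) (Set.Ici T) := by
    refine antitoneOn_of_deriv_nonpos (convex_Ici T)
      (fun t ht => (hderiv t ht).continuousAt.continuousWithinAt)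
      (fun t ht => (hderiv t (interior_subset ht)).differentiableAt.differentiableWithinAt)
      fun t ht => ?_
    have ht' : T ≤ t := interior_subset ht
    rw [(hderiv t ht').deriv]
    nlinarith [mul_le_mul_of_nonneg_left (hV' t ht') (Real.exp_pos (k * t)).le]
  have hlim : Tendsto (fun t => Real.exp (k * t) * (c - m)) atTop atTop :=
    (Real.tendsto_exp_atTop.comp (tendsto_id.const_mul_atTop hk)).atTop_mul_const
      (sub_pos.mpr hc)
  filter_upwards [eventually_ge_atTop T,
    hlim.eventually_gt_atTop (Real.exp (k * T) * (V T - m))] with t ht hlt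
  have hle := hanti Set.self_mem_Ici ht ht
  have := lt_of_mul_lt_mul_left (hle.trans_lt hlt) (Real.exp_pos (k * t)).le
  linarith

/-- If `q' = -A q + w` with `A` coercive of constant `k` and `‖w‖` is eventually at most `b`, then
`‖q‖` is eventually below every level above `b / k`. -/
lemma eventually_norm_lt_of_coercive {E : Type*} [NormedAddCommGroup E] [InnerProductSpace ℝ E]
    {A : E →ₗ[ℝ] E} {w q : ℝ → E} {k b c T₀ : ℝ} (hk : 0 < k)
    (hA : ∀ x, k * ‖x‖ ^ 2 ≤ inner ℝ x (A x))
    (hq : ∀ t, T₀ ≤ t → HasDerivAt q (-(A (q t)) + w t) t)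
    (hb : 0 ≤ b) (hw : ∀ᶠ t in atTop, ‖w t‖ ≤ b) (hc : b / k < c) :
    ∀ᶠ t in atTop, ‖q t‖ < c := by
  obtain ⟨T, hT⟩ := eventually_atTop.mp (hw.and (eventually_ge_atTop T₀))
  have hbk : 0 ≤ b / k := by positivity
  have hV' (t : ℝ) (ht : T ≤ t) :
      2 * inner ℝ (q t) (-(A (q t)) + w t) ≤ -k * (‖q t‖ ^ 2 - (b / k) ^ 2) := by
    have hinner : inner ℝ (q t) (w t) ≤ ‖q t‖ * b :=
      (real_inner_le_norm _ _).trans (mul_le_mul_of_nonneg_left (hT t ht).1 (norm_nonneg _))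
    have hbmul : b = k * (b / k) := by field_simp
    rw [hbmul] at hinner
    rw [inner_add_right, inner_neg_right]
    nlinarith [hA (q t), mul_nonneg hk.le (sq_nonneg (‖q t‖ - b / k))]
  filter_upwards [eventually_lt_of_hasDerivAt_le hk
    (fun t ht => (hq t (hT t ht).2).norm_sq) hV' (pow_lt_pow_left₀ hc hbk two_ne_zero)] with t ht
  exact lt_of_pow_lt_pow_left₀ 2 (hbk.trans hc.le) ht

/-- Proposition 2, joint position error. Let `n ≥ 1`, let `K_q` be an
`n×n` real symmetric positive definite matrix with smallest eigenvalue `k > 0`, let `w`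
be continuous, and let `q` be differentiable with `q′(t) = −K_q q(t) + w(t)` for all
`t ≥ 0`. Then `limsup_{t→∞} ‖q(t)‖ ≤ (1/λ_min(K_q))·limsup_{t→∞} ‖w(t)‖`. -/
theorem iss_joint_position_error (n : ℕ) (hn : 1 ≤ n)
    (Kq : Matrix (Fin n) (Fin n) ℝ) (hK : Kq.PosDef)
    (k : ℝ) (hk : 0 < k) (hkmin : IsLeast (Set.range hK.isHermitian.eigenvalues) k)
    (w q : ℝ → EuclideanSpace ℝ (Fin n)) (hw : Continuous w)
    (hq : ∀ t, 0 ≤ t → HasDerivAt q (-(Matrix.toEuclideanLin Kq (q t)) + w t) t) :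
    limsup (fun t => (‖q t‖₊ : ℝ≥0∞)) atTop ≤
      ENNReal.ofReal (1 / k) * limsup (fun t => (‖w t‖₊ : ℝ≥0∞)) atTop := by
  have hA := hK.isHermitian.mul_norm_sq_le_inner_toEuclideanLin
    fun i => hkmin.2 (Set.mem_range_self i)
  refine le_of_forall_gt_imp_ge_of_dense fun c hc => ?_
  rcases eq_or_ne c ⊤ with rfl | hctop
  · exact le_top
  lift c to NNReal using hctop
  have hpos : ENNReal.ofReal (1 / k) ≠ 0 := by simpa using hk
  have hlt : limsup (fun t => (‖w t‖₊ : ℝ≥0∞)) atTop < c / ENNReal.ofReal (1 / k) := by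
    rwa [ENNReal.lt_div_iff_mul_lt (Or.inl hpos) (Or.inl ENNReal.ofReal_ne_top), mul_comm]
  obtain ⟨b, hwb, hbc⟩ := ENNReal.lt_iff_exists_nnreal_btwn.mp hlt
  have hbk : (b : ℝ) / k < c := by
    rw [ENNReal.lt_div_iff_mul_lt (Or.inl hpos) (Or.inl ENNReal.ofReal_ne_top),
      ← ENNReal.ofReal_coe_nnreal, ← ENNReal.ofReal_mul b.coe_nonneg,
      ← ENNReal.ofReal_coe_nnreal (p := c),
      ENNReal.ofReal_lt_ofReal_iff_of_nonneg (by positivity)] at hbc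
    simpa [div_eq_mul_inv] using hbc
  have hwev : ∀ᶠ t in atTop, ‖w t‖ ≤ b := by
    filter_upwards [eventually_lt_of_limsup_lt hwb] with t ht
    exact_mod_cast ht.le
  refine limsup_le_of_le (h := ?_)
  filter_upwards [eventually_norm_lt_of_coercive hk hA hq b.coe_nonneg hwev hbk] with t ht
  exact_mod_cast ht.le
end
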